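/- arXiv:0712.3093 — 2 statements merged into one kernel-verified Lean document; each statement's English description precedes it below -/
import Mathlib

section
/- Let d ≥ 1, let A and B be nonsingular real d×d matrices, and let Ω_A, Ω_B ⊂ ℝ^d be bounded sets, each containing 0 in its interior, whose translates {Ω_A + Ak : k ∈ ℤ^d} (resp. {Ω_B + Bk : k ∈ ℤ^d}) are pairwise disjoint and cover ℝ^d pointwise. Assume N = Bᵀ A has integer entries; set Λ_N = {k ∈ ℤ^d : B^{−T}k ∈ Ω_A}, Λ_{Nᵀ} = {k ∈ ℤ^d : A^{−T}k ∈ Ω_B}, and Ψ(x) = (1/|det N|) Σ_{j ∈ Λ_{Nᵀ}} exp(2πi jᵀ A^{−1} x). Then: (1) the cardinalities satisfy #Λ_N = #Λ_{Nᵀ} = |det N|; (2) for every function f : ℝ^d → ℂ, the function I_N f(x) = Σ_{k ∈ Λ_N} f(B^{−T}k) Ψ(x − B^{−T}k) satisfies I_N f(B^{−T}j) = f(B^{−T}j) for all j ∈ Λ_N; and (3) I_N f is the unique function in the complex span of {x ↦ exp(2πi kᵀ A^{−1} x) : k ∈ Λ_{Nᵀ}} taking the values f(B^{−T}j) at the points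 B^{−T}j, j ∈ Λ_N. -/
open Matrix MeasureTheory
open scoped Classical

noncomputable section

/-- The integer vector `k` viewed as a real vector. -/
def intVec {d : ℕ} (k : Fin d → ℤ) : Fin d → ℝ := fun i => (k i : ℝ)

/-- The set `Λ_M(Ω) = {k ∈ ℤ^d : M^{-T} k ∈ Ω}`. -/
def LamSet {d : ℕ} (M : Matrix (Fin d) (Fin d) ℝ) (Ω : Set (Fin d → ℝ)) :
    Set (Fin d → ℤ) :=
  {k | (Mᵀ)⁻¹.mulVec (intVec k) ∈ Ω}

/-- The exponential `x ↦ exp(2πi kᵀ A⁻¹ x)`. -/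
def expFun {d : ℕ} (A : Matrix (Fin d) (Fin d) ℝ) (k : Fin d → ℤ) :
    (Fin d → ℝ) → ℂ := fun x =>
  Complex.exp (2 * (Real.pi : ℂ) * Complex.I *
    ((intVec k ⬝ᵥ A⁻¹.mulVec x : ℝ) : ℂ))

/-- The fundamental interpolation function
`Ψ(x) = (1/|det N|) Σ_{j ∈ Λ_{Nᵀ}} exp(2πi jᵀ A⁻¹ x)`. -/
def PsiFun {d : ℕ} (A : Matrix (Fin d) (Fin d) ℝ) (ΛNt : Set (Fin d → ℤ))
    (detN : ℤ) : (Fin d → ℝ) → ℂ := fun x =>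
  ((|(detN : ℝ)|⁻¹ : ℝ) : ℂ) * ∑ᶠ j ∈ ΛNt, expFun A j x

/-- `Λ` contains exactly one representative of each class of `ℤ^d` modulo `N ℤ^d`. -/
def IsTransversalMod {d : ℕ} (N : Matrix (Fin d) (Fin d) ℤ) (Λ : Set (Fin d → ℤ)) : Prop :=
  ∀ k : Fin d → ℤ, ∃! m : Fin d → ℤ, k + N *ᵥ m ∈ Λ

lemma intVec_add {d : ℕ} (k l : Fin d → ℤ) : intVec (k + l) = intVec k + intVec l := by
  ext i; simp [intVec]

lemma intVec_sub {d : ℕ} (k l : Fin d → ℤ) : intVec (k - l) = intVec k - intVec l := by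
  ext i; simp [intVec]

lemma intVec_injective {d : ℕ} : Function.Injective (intVec (d := d)) := by
  intro k l h
  ext i
  exact Int.cast_injective (congrFun h i)

lemma intVec_mulVec {d : ℕ} (N : Matrix (Fin d) (Fin d) ℤ) (m : Fin d → ℤ) :
    intVec (N *ᵥ m) = N.map ((↑) : ℤ → ℝ) *ᵥ intVec m := by
  ext i; simp [intVec, Matrix.mulVec, dotProduct]

lemma intVec_dotProduct {d : ℕ} (k l : Fin d → ℤ) :
    intVec k ⬝ᵥ intVec l = ((k ⬝ᵥ l : ℤ) : ℝ) := by
  simp [intVec, dotProduct]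

lemma cexp_two_pi_mul_I_eq_one_iff (x : ℝ) :
    Complex.exp (2 * (Real.pi : ℂ) * Complex.I * (x : ℂ)) = 1 ↔ ∃ n : ℤ, x = n := by
  rw [Complex.exp_eq_one_iff]
  refine exists_congr fun n => ?_
  rw [mul_comm (n : ℂ), mul_right_inj' Complex.two_pi_I_ne_zero]
  norm_cast

/-- If `Ω` tiles under `A ℤ^d`, the points of `B^{-T} ℤ^d` in `Ω` give a set of representatives
modulo `Bᵀ A`. -/
lemma isTransversalMod_LamSet {d : ℕ} {A B : Matrix (Fin d) (Fin d) ℝ} (hB : B.det ≠ 0)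
    {Ω : Set (Fin d → ℝ)}
    (htile : ∀ x : Fin d → ℝ, ∃! k : Fin d → ℤ, x + A.mulVec (intVec k) ∈ Ω)
    {N : Matrix (Fin d) (Fin d) ℤ} (hN : N.map ((↑) : ℤ → ℝ) = Bᵀ * A) :
    IsTransversalMod N (LamSet B Ω) := by
  intro k
  have hu : IsUnit Bᵀ.det := by rw [det_transpose]; exact hB.isUnit
  have key : ∀ m, k + N *ᵥ m ∈ LamSet B Ω ↔
      (Bᵀ)⁻¹ *ᵥ intVec k + A *ᵥ intVec m ∈ Ω := by
    intro m
    rw [LamSet, Set.mem_ofPred_eq, intVec_add, intVec_mulVec, mulVec_add, hN, mulVec_mulVec,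
      nonsing_inv_mul_cancel_left _ _ hu]
  simpa only [key] using htile ((Bᵀ)⁻¹ *ᵥ intVec k)

namespace IsTransversalMod

variable {d : ℕ} {N : Matrix (Fin d) (Fin d) ℤ} {Λ : Set (Fin d → ℤ)}

lemma eq_of_sub_eq (h : IsTransversalMod N Λ) {k l m : Fin d → ℤ} (hk : k ∈ Λ) (hl : l ∈ Λ)
    (hm : k - l = N *ᵥ m) : k = l := by
  have : m = 0 := (h l).unique (by rwa [← hm, add_sub_cancel]) (by simpa using hl)
  rw [this, mulVec_zero, sub_eq_zero] at hm
  exact hm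

lemma bijective_mkQ (h : IsTransversalMod N Λ) :
    Function.Bijective fun k : Λ => (LinearMap.range N.mulVecLin).mkQ (k : Fin d → ℤ) := by
  constructor
  · rintro ⟨k, hk⟩ ⟨l, hl⟩ hkl
    obtain ⟨m, hm⟩ := (Submodule.Quotient.eq _).1 hkl
    exact Subtype.ext (h.eq_of_sub_eq hk hl hm.symm)
  · intro g
    obtain ⟨k, rfl⟩ := Submodule.mkQ_surjective _ g
    obtain ⟨m, hm, -⟩ := h k
    refine ⟨⟨_, hm⟩, (Submodule.Quotient.eq _).2 ⟨m, ?_⟩⟩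
    simp

lemma ncard_eq (h : IsTransversalMod N Λ) (hdet : N.det ≠ 0) : Λ.ncard = N.det.natAbs := by
  rw [← Nat.card_coe_set_eq, Nat.card_congr (Equiv.ofBijective _ h.bijective_mkQ)]
  have hinj : Function.Injective N.mulVecLin := 
    mulVec_injective_of_det_mem_nonZeroDivisors (mem_nonZeroDivisors_of_ne_zero hdet)
  rw [← Submodule.natAbs_det_equiv _ (LinearEquiv.ofInjective N.mulVecLin hinj)]
  rw [← LinearMap.det_toLin' N]
  rfl

lemma finite (h : IsTransversalMod N Λ) (hdet : N.det ≠ 0) : Λ.Finite :=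
  Set.finite_of_ncard_ne_zero (by rw [h.ncard_eq hdet]; exact Int.natAbs_ne_zero.2 hdet)

/-- The character sum over a transversal is `|det N|` for the trivial character and `0`
otherwise. -/
lemma finsum_exp (h : IsTransversalMod N Λ) (hdet : N.det ≠ 0) (w : Fin d → ℝ)
    (hw : ∀ m : Fin d → ℤ, ∃ n : ℤ, intVec (N *ᵥ m) ⬝ᵥ w = n) :
    ∑ᶠ k ∈ Λ, Complex.exp (2 * (Real.pi : ℂ) * Complex.I * ((intVec k ⬝ᵥ w : ℝ) : ℂ)) =
      if ∃ m, w = intVec m then ((|(N.det : ℝ)| : ℝ) : ℂ) else 0 := by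
  set E : (Fin d → ℤ) → ℂ := fun k =>
    Complex.exp (2 * (Real.pi : ℂ) * Complex.I * ((intVec k ⬝ᵥ w : ℝ) : ℂ)) with hE
  have hfin := h.finite hdet
  split_ifs with hm
  · obtain ⟨m, rfl⟩ := hm
    have h1 : ∀ k ∈ Λ, E k = 1 := fun k _ =>
      (cexp_two_pi_mul_I_eq_one_iff _).2 ⟨_, intVec_dotProduct k m⟩
    rw [finsum_mem_congr rfl h1, finsum_mem_eq_finite_toFinset_sum _ hfin, Finset.sum_const,
      ← Set.ncard_eq_toFinset_card _ hfin, h.ncard_eq hdet, nsmul_one, ← Int.cast_abs,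
      Int.abs_eq_natAbs, Int.cast_natCast, Complex.ofReal_natCast]
  · have hadd : ∀ k l, E (k + l) = E k * E l := by
      intro k l
      simp only [hE]
      rw [intVec_add, add_dotProduct, ← Complex.exp_add]
      push_cast
      ring_nf
    have hper : ∀ m, E (N *ᵥ m) = 1 := fun m => (cexp_two_pi_mul_I_eq_one_iff _).2 (hw m)
    obtain ⟨a, ha⟩ : ∃ a, E a ≠ 1 := by
      by_contra! hall
      refine hm ?_
      have : ∀ i, ∃ n : ℤ, w i = n := by
        intro i
        obtain ⟨n, hn⟩ := (cexp_two_pi_mul_I_eq_one_iff _).1 (hall (Pi.single i 1))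
        refine ⟨n, ?_⟩
        rw [← hn]
        have : intVec (Pi.single i (1 : ℤ)) = Pi.single i (1 : ℝ) := by
          ext j
          by_cases hj : j = i
          · subst hj; simp [intVec]
          · simp [intVec, hj]
        rw [this, single_dotProduct, one_mul]
      choose n hn using this
      exact ⟨n, funext hn⟩
    choose r hr using fun k => (h k).exists
    have hS : ∑ᶠ k ∈ Λ, E k = E a * ∑ᶠ k ∈ Λ, E k := by
      rw [mul_finsum_mem' _ _ hfin]
      symm
      refine finsum_mem_eq_of_bijOn (fun k => k + a + N *ᵥ r (k + a)) ⟨?_, ?_, ?_⟩ ?_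
      · exact fun k _ => hr (k + a)
      · intro k hk l hl hkl
        refine h.eq_of_sub_eq (m := r (l + a) - r (k + a)) hk hl ?_
        rw [mulVec_sub]
        linear_combination hkl
      · intro l hl
        refine ⟨l - a + N *ᵥ r (l - a), hr (l - a), ?_⟩
        refine h.eq_of_sub_eq
          (m := r (l - a) + r (l - a + N *ᵥ r (l - a) + a)) (hr _) hl ?_
        beta_reduce
        rw [mulVec_add]
        abel
      · intro k _
        rw [hadd, hper, hadd, mul_one, mul_comm]
    have : (1 - E a) * ∑ᶠ k ∈ Λ, E k = 0 := by linear_combination hS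
    exact (mul_eq_zero.1 this).resolve_left (sub_ne_zero.2 ha.symm)

end IsTransversalMod

lemma expFun_sub {d : ℕ} (A : Matrix (Fin d) (Fin d) ℝ) (k : Fin d → ℤ) (x y : Fin d → ℝ) :
    expFun A k (x - y) = expFun A k x * expFun A k (-y) := by
  simp only [expFun]
  rw [← Complex.exp_add, sub_eq_add_neg, mulVec_add, dotProduct_add]
  push_cast
  ring_nf

lemma dotProduct_inv_mulVec_comm {d : ℕ} (A B : Matrix (Fin d) (Fin d) ℝ) (u v : Fin d → ℝ) :
    u ⬝ᵥ A⁻¹ *ᵥ (Bᵀ)⁻¹ *ᵥ v = v ⬝ᵥ B⁻¹ *ᵥ (Aᵀ)⁻¹ *ᵥ u := by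
  rw [dotProduct_mulVec, ← mulVec_transpose, transpose_nonsing_inv, dotProduct_mulVec,
    ← mulVec_transpose, transpose_nonsing_inv, transpose_transpose, dotProduct_comm]

/-- Exchanging frequencies and sampling nodes exchanges `A` and `B`. -/
lemma expFun_mul_expFun_neg {d : ℕ} (A B : Matrix (Fin d) (Fin d) ℝ) (j l k : Fin d → ℤ) :
    expFun A j ((Bᵀ)⁻¹ *ᵥ intVec k) * expFun A l (-((Bᵀ)⁻¹ *ᵥ intVec k)) =
      expFun B k ((Aᵀ)⁻¹ *ᵥ intVec j - (Aᵀ)⁻¹ *ᵥ intVec l) := by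
  simp only [expFun]
  rw [← Complex.exp_add, mulVec_sub, dotProduct_sub, mulVec_neg, dotProduct_neg,
    dotProduct_inv_mulVec_comm, dotProduct_inv_mulVec_comm A B (intVec l)]
  push_cast
  ring_nf

/-- Orthogonality of the exponentials on the sampling nodes. -/
lemma finsum_expFun {d : ℕ} {A B : Matrix (Fin d) (Fin d) ℝ} (hA : A.det ≠ 0) (hB : B.det ≠ 0)
    {ΩA ΩB : Set (Fin d → ℝ)}
    (htileA : ∀ x : Fin d → ℝ, ∃! k : Fin d → ℤ, x + A.mulVec (intVec k) ∈ ΩA)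
    (htileB : ∀ x : Fin d → ℝ, ∃! k : Fin d → ℤ, x + B.mulVec (intVec k) ∈ ΩB)
    {N : Matrix (Fin d) (Fin d) ℤ} (hdet : N.det ≠ 0) (hN : N.map ((↑) : ℤ → ℝ) = Bᵀ * A)
    (hNT : Nᵀ.map ((↑) : ℤ → ℝ) = Aᵀ * B)
    {k l : Fin d → ℤ} (hk : k ∈ LamSet B ΩA) (hl : l ∈ LamSet B ΩA) :
    ∑ᶠ j ∈ LamSet A ΩB, expFun A j ((Bᵀ)⁻¹ *ᵥ intVec k - (Bᵀ)⁻¹ *ᵥ intVec l) =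
      if k = l then ((|(N.det : ℝ)| : ℝ) : ℂ) else 0 := by
  have hΛ := isTransversalMod_LamSet hB htileA hN
  have hΛT := isTransversalMod_LamSet hA htileB hNT
  have huB : IsUnit Bᵀ.det := by rw [det_transpose]; exact hB.isUnit
  set w := A⁻¹ *ᵥ ((Bᵀ)⁻¹ *ᵥ intVec k - (Bᵀ)⁻¹ *ᵥ intVec l) with hw
  have hNw : (Bᵀ * A) *ᵥ w = intVec (k - l) := by
    rw [hw, ← mulVec_sub, intVec_sub, mulVec_mulVec, mulVec_mulVec,
      mul_nonsing_inv_cancel_right _ _ hA.isUnit, mul_nonsing_inv _ huB, one_mulVec]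
  have hsum := hΛT.finsum_exp (by rwa [det_transpose]) w ?_
  · refine hsum.trans ?_
    rw [det_transpose]
    congr 1
    refine propext ⟨?_, ?_⟩
    · rintro ⟨m, hm⟩
      refine hΛ.eq_of_sub_eq (m := m) hk hl (intVec_injective ?_)
      rw [← hNw, intVec_mulVec, hN, hm]
    · rintro rfl
      refine ⟨0, ?_⟩
      rw [hw, sub_self, mulVec_zero]
      ext i
      simp [intVec]
  · intro m
    clear_value w
    refine ⟨m ⬝ᵥ (k - l), ?_⟩
    rw [← intVec_dotProduct, ← hNw, intVec_mulVec, hNT, dotProduct_mulVec, ← mulVec_transpose,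
      transpose_mul, transpose_transpose]

theorem stmt_2 (d : ℕ) (hd : 1 ≤ d)
    (A B : Matrix (Fin d) (Fin d) ℝ) (hA : A.det ≠ 0) (hB : B.det ≠ 0)
    (ΩA ΩB : Set (Fin d → ℝ))
    (hΩAbd : Bornology.IsBounded ΩA) (hΩBbd : Bornology.IsBounded ΩB)
    (hΩA0 : (0 : Fin d → ℝ) ∈ interior ΩA)
    (hΩB0 : (0 : Fin d → ℝ) ∈ interior ΩB)
    (htileA : ∀ x : Fin d → ℝ, ∃! k : Fin d → ℤ, x + A.mulVec (intVec k) ∈ ΩA)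
    (htileB : ∀ x : Fin d → ℝ, ∃! k : Fin d → ℤ, x + B.mulVec (intVec k) ∈ ΩB)
    (N : Matrix (Fin d) (Fin d) ℤ)
    (hN : N.map ((↑) : ℤ → ℝ) = Bᵀ * A) :
    -- (1) cardinalities
    ((LamSet B ΩA).ncard = (LamSet A ΩB).ncard ∧
      (LamSet B ΩA).ncard = N.det.natAbs) ∧
    -- (2) interpolation property
    (∀ f : (Fin d → ℝ) → ℂ, ∀ j ∈ LamSet B ΩA,
      (∑ᶠ k ∈ LamSet B ΩA,
          f ((Bᵀ)⁻¹.mulVec (intVec k)) *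
            PsiFun A (LamSet A ΩB) N.det
              ((Bᵀ)⁻¹.mulVec (intVec j) - (Bᵀ)⁻¹.mulVec (intVec k))) =
        f ((Bᵀ)⁻¹.mulVec (intVec j))) ∧
    -- (3) membership in the span and uniqueness
    (∀ f : (Fin d → ℝ) → ℂ,
      (fun x => ∑ᶠ k ∈ LamSet B ΩA,
          f ((Bᵀ)⁻¹.mulVec (intVec k)) *
            PsiFun A (LamSet A ΩB) N.det (x - (Bᵀ)⁻¹.mulVec (intVec k))) ∈
        Submodule.span ℂ {F | ∃ k ∈ LamSet A ΩB, F = expFun A k} ∧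
      ∀ h ∈ Submodule.span ℂ {F | ∃ k ∈ LamSet A ΩB, F = expFun A k},
        (∀ j ∈ LamSet B ΩA,
            h ((Bᵀ)⁻¹.mulVec (intVec j)) = f ((Bᵀ)⁻¹.mulVec (intVec j))) →
        h = fun x => ∑ᶠ k ∈ LamSet B ΩA,
          f ((Bᵀ)⁻¹.mulVec (intVec k)) *
            PsiFun A (LamSet A ΩB) N.det (x - (Bᵀ)⁻¹.mulVec (intVec k))) := by
  have hNT : Nᵀ.map ((↑) : ℤ → ℝ) = Aᵀ * B := by
    rw [transpose_map, hN, transpose_mul, transpose_transpose]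
  have hdet : N.det ≠ 0 := by
    intro h0
    have h1 : ((N.det : ℤ) : ℝ) = (N.map ((↑) : ℤ → ℝ)).det := (Int.castRingHom ℝ).map_det N
    rw [h0, hN, det_mul, det_transpose] at h1
    exact mul_ne_zero hB hA (by simpa using h1.symm)
  have hdetT : Nᵀ.det ≠ 0 := by rwa [det_transpose]
  have hΛ := isTransversalMod_LamSet hB htileA hN
  have hΛT := isTransversalMod_LamSet hA htileB hNT
  have hfin := hΛ.finite hdet
  have hfinT := hΛT.finite hdetT
  have hD : ((|(N.det : ℝ)| : ℝ) : ℂ) ≠ 0 := by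
    simpa using hdet
  have hinterp : ∀ f : (Fin d → ℝ) → ℂ, ∀ j ∈ LamSet B ΩA,
      (∑ᶠ k ∈ LamSet B ΩA, f ((Bᵀ)⁻¹.mulVec (intVec k)) * PsiFun A (LamSet A ΩB) N.det
        ((Bᵀ)⁻¹.mulVec (intVec j) - (Bᵀ)⁻¹.mulVec (intVec k))) =
        f ((Bᵀ)⁻¹.mulVec (intVec j)) := by
    intro f j hj
    have hterm : ∀ k ∈ LamSet B ΩA, f ((Bᵀ)⁻¹.mulVec (intVec k)) * PsiFun A (LamSet A ΩB) N.det
        ((Bᵀ)⁻¹.mulVec (intVec j) - (Bᵀ)⁻¹.mulVec (intVec k)) =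
        if j = k then f ((Bᵀ)⁻¹.mulVec (intVec j)) else 0 := by
      intro k hk
      rw [PsiFun, finsum_expFun hA hB htileA htileB hdet hN hNT hj hk]
      split_ifs with hjk
      · rw [hjk, Complex.ofReal_inv, inv_mul_cancel₀ hD, mul_one]
      · simp
    rw [finsum_mem_congr rfl hterm, finsum_mem_eq_finite_toFinset_sum _ hfin]
    simp [hj]
  have hPsi : ∀ x y, PsiFun A (LamSet A ΩB) N.det (x - y) =
      ∑ l ∈ hfinT.toFinset, ((|(N.det : ℝ)| : ℝ) : ℂ)⁻¹ * expFun A l (-y) * expFun A l x := by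
    intro x y
    rw [PsiFun, finsum_mem_eq_finite_toFinset_sum _ hfinT, Finset.mul_sum, Complex.ofReal_inv]
    refine Finset.sum_congr rfl fun l _ => ?_
    rw [expFun_sub]
    ring
  have hexpand : ∀ f : (Fin d → ℝ) → ℂ,
      (fun x => ∑ᶠ k ∈ LamSet B ΩA, f ((Bᵀ)⁻¹.mulVec (intVec k)) *
        PsiFun A (LamSet A ΩB) N.det (x - (Bᵀ)⁻¹.mulVec (intVec k))) =
      ∑ l ∈ hfinT.toFinset, (((|(N.det : ℝ)| : ℝ) : ℂ)⁻¹ * ∑ᶠ k ∈ LamSet B ΩA,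
        f ((Bᵀ)⁻¹ *ᵥ intVec k) * expFun A l (-((Bᵀ)⁻¹ *ᵥ intVec k))) • expFun A l := by
    intro f
    ext x
    simp only [hPsi, finsum_mem_eq_finite_toFinset_sum _ hfin, Finset.sum_apply, Pi.smul_apply,
      smul_eq_mul, Finset.mul_sum, Finset.sum_mul]
    rw [Finset.sum_comm]
    refine Finset.sum_congr rfl fun l _ => Finset.sum_congr rfl fun k _ => ?_
    ring
  have hrepro : ∀ h ∈ Submodule.span ℂ {F | ∃ k ∈ LamSet A ΩB, F = expFun A k},
      h = fun x => ∑ᶠ k ∈ LamSet B ΩA, h ((Bᵀ)⁻¹.mulVec (intVec k)) *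
        PsiFun A (LamSet A ΩB) N.det (x - (Bᵀ)⁻¹.mulVec (intVec k)) := by
    intro h hh
    induction hh using Submodule.span_induction with
    | mem F hF =>
      obtain ⟨j, hj, rfl⟩ := hF
      rw [hexpand]
      have hcoef : ∀ l ∈ hfinT.toFinset, (((|(N.det : ℝ)| : ℝ) : ℂ)⁻¹ * ∑ᶠ k ∈ LamSet B ΩA,
          expFun A j ((Bᵀ)⁻¹ *ᵥ intVec k) * expFun A l (-((Bᵀ)⁻¹ *ᵥ intVec k))) • expFun A l =
          if j = l then expFun A j else 0 := by
        intro l hl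
        simp only [expFun_mul_expFun_neg]
        rw [finsum_expFun hB hA htileB htileA hdetT hNT (by rwa [transpose_transpose]) hj
          (hfinT.mem_toFinset.1 hl), det_transpose]
        split_ifs with hjl
        · rw [hjl, inv_mul_cancel₀ hD, one_smul]
        · simp
      rw [Finset.sum_congr rfl hcoef]
      simp [hj]
    | zero =>
      ext x
      simp
    | add g₁ g₂ _ _ h₁ h₂ =>
      ext x
      simp only [Pi.add_apply, add_mul]
      rw [finsum_mem_add_distrib hfin]
      exact congrArg₂ (· + ·) (congrFun h₁ x) (congrFun h₂ x)
    | smul c g _ hg =>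
      ext x
      simp only [Pi.smul_apply, smul_eq_mul, mul_assoc]
      rw [← mul_finsum_mem' _ _ hfin]
      exact congrArg (c * ·) (congrFun hg x)
  refine ⟨⟨?_, hΛ.ncard_eq hdet⟩, hinterp, fun f => ⟨?_, fun h hh hval => ?_⟩⟩
  · rw [hΛ.ncard_eq hdet, hΛT.ncard_eq hdetT, det_transpose]
  · rw [hexpand]
    exact Submodule.sum_mem _ fun l hl => Submodule.smul_mem _ _
      (Submodule.subset_span ⟨l, hfinT.mem_toFinset.1 hl, rfl⟩)
  · refine (hrepro h hh).trans (funext fun x => finsum_mem_congr rfl fun k hk => ?_)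
    rw [hval k hk]
end
end

section
/- Let n ≥ 1. For every pair of functions f, g in the complex linear span of {φ_j : j ∈ ℍ_n}, one has ⟨f, g⟩_H = (1/(3n²)) Σ_{j ∈ ℍ_n} f(j/n) conj(g(j/n)) = (1/(3n²)) Σ_{j ∈ ℍ_n*} c_j^{(n)} f(j/n) conj(g(j/n)). -/
open MeasureTheory
open scoped Real Classical

noncomputable section

/-- `φ_j(t) = exp(2πi (j₁t₁ + j₂t₂ + j₃t₃)/3)` for `j ∈ ℤ³`, `t ∈ ℝ³`. -/
def phi (j : ℤ × ℤ × ℤ) (t : ℝ × ℝ × ℝ) : ℂ :=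
  Complex.exp (2 * (Real.pi : ℂ) * Complex.I *
    ((j.1 : ℂ) * (t.1 : ℂ) + (j.2.1 : ℂ) * (t.2.1 : ℂ) + (j.2.2 : ℂ) * (t.2.2 : ℂ)) / 3)

/-- `ℍ_n = {j ∈ ℍ : -n ≤ j₁ < n, -n ≤ j₂ < n, -n ≤ -j₃ < n}`. -/
def Hn (n : ℕ) : Set (ℤ × ℤ × ℤ) :=
  {j | j.1 + j.2.1 + j.2.2 = 0 ∧ -(n : ℤ) ≤ j.1 ∧ j.1 < n ∧
       -(n : ℤ) ≤ j.2.1 ∧ j.2.1 < n ∧ -(n : ℤ) ≤ -j.2.2 ∧ -j.2.2 < n}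

/-- `ℍ_n* = {j ∈ ℍ : -n ≤ j₁, j₂, j₃ ≤ n}`. -/
def Hstar (n : ℕ) : Set (ℤ × ℤ × ℤ) :=
  {j | j.1 + j.2.1 + j.2.2 = 0 ∧ -(n : ℤ) ≤ j.1 ∧ j.1 ≤ n ∧
       -(n : ℤ) ≤ j.2.1 ∧ j.2.1 ≤ n ∧ -(n : ℤ) ≤ j.2.2 ∧ j.2.2 ≤ n}

/-- `ℍ_n° = {j ∈ ℍ : -n < j₁, j₂, j₃ < n}`. -/
def Hcirc (n : ℕ) : Set (ℤ × ℤ × ℤ) :=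
  {j | j.1 + j.2.1 + j.2.2 = 0 ∧ -(n : ℤ) < j.1 ∧ j.1 < n ∧
       -(n : ℤ) < j.2.1 ∧ j.2.1 < n ∧ -(n : ℤ) < j.2.2 ∧ j.2.2 < n}

/-- The weights `c_j^{(n)}`: 1 on interior points, 1/2 on edge points, 1/3 on vertices. -/
def cwt (n : ℕ) (j : ℤ × ℤ × ℤ) : ℝ :=
  if -(n : ℤ) < j.1 ∧ j.1 < n ∧ -(n : ℤ) < j.2.1 ∧ j.2.1 < n ∧
      -(n : ℤ) < j.2.2 ∧ j.2.2 < n then 1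
  else if j.1 * j.2.1 * j.2.2 ≠ 0 then 1 / 2 else 1 / 3

/-- The point `j/n = (j₁/n, j₂/n, j₃/n)`. -/
def pt (n : ℕ) (j : ℤ × ℤ × ℤ) : ℝ × ℝ × ℝ :=
  ((j.1 : ℝ) / n, (j.2.1 : ℝ) / n, (j.2.2 : ℝ) / n)

/-- Homogeneous coordinates `t(x) = (-x₂/2 + √3 x₁/2, x₂, -x₂/2 - √3 x₁/2)`. -/
def Tmap (x : ℝ × ℝ) : ℝ × ℝ × ℝ :=
  (-x.2 / 2 + Real.sqrt 3 * x.1 / 2, x.2, -x.2 / 2 - Real.sqrt 3 * x.1 / 2)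

/-- The planar hexagon `Ω_H` (of area 2√3). -/
def OmegaH : Set (ℝ × ℝ) :=
  {x | -1 ≤ (Tmap x).1 ∧ (Tmap x).1 < 1 ∧ -1 ≤ (Tmap x).2.1 ∧ (Tmap x).2.1 < 1 ∧
       -1 ≤ -(Tmap x).2.2 ∧ -(Tmap x).2.2 < 1}

/-- `⟨f,g⟩_H = (1/(2√3)) ∫_{Ω_H} f(t(x)) conj(g(t(x))) dx`. -/
def innerH (f g : ℝ × ℝ × ℝ → ℂ) : ℂ :=
  ((1 / (2 * Real.sqrt 3) : ℝ) : ℂ) *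
    ∫ x in OmegaH, f (Tmap x) * (starRingEnd ℂ) (g (Tmap x))

theorem phi_mul_conj_phi (k l : ℤ × ℤ × ℤ) (t : ℝ × ℝ × ℝ) :
    phi k t * (starRingEnd ℂ) (phi l t) = phi (k - l) t := by
  simp only [phi, ← Complex.exp_conj, ← Complex.exp_add]
  congr 1
  simp only [map_div₀, map_mul, map_add, Complex.conj_ofReal, Complex.conj_I, map_intCast,
    map_ofNat, Prod.fst_sub, Prod.snd_sub, Int.cast_sub]
  ring

theorem continuous_phi (k : ℤ × ℤ × ℤ) : Continuous (phi k) := by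
  unfold phi
  fun_prop

theorem phi_zero (t : ℝ × ℝ × ℝ) : phi 0 t = 1 := by
  simp [phi]

theorem exp_two_pi_mul_int (m : ℤ) : Complex.exp (2 * π * Complex.I * m) = 1 :=
  Complex.exp_eq_one_iff.2 ⟨m, by ring⟩

/-! ### The integral over the hexagon -/

/-- The linear map `x ↦ (t₁, t₂)` taking planar to the first two homogeneous coordinates. -/
def homogeneousCoord : ℝ × ℝ →ₗ[ℝ] ℝ × ℝ where
  toFun x := (-x.2 / 2 + Real.sqrt 3 * x.1 / 2, x.2)
  map_add' x y := by ext <;> simp; ring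
  map_smul' c x := by ext <;> simp; ring

theorem det_homogeneousCoord : LinearMap.det homogeneousCoord = Real.sqrt 3 / 2 := by
  rw [← LinearMap.det_toMatrix (Module.Basis.finTwoProd ℝ), Matrix.det_fin_two]
  simp [LinearMap.toMatrix_apply, homogeneousCoord]

/-- The hexagon in the coordinates `(t₁, t₂)`. -/
def hexagon : Set (ℝ × ℝ) :=
  {u | -1 ≤ u.1 ∧ u.1 < 1 ∧ -1 ≤ u.2 ∧ u.2 < 1 ∧ -1 ≤ u.1 + u.2 ∧ u.1 + u.2 < 1}

theorem measurableSet_hexagon : MeasurableSet hexagon := by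
  unfold hexagon
  measurability

theorem isBounded_hexagon : Bornology.IsBounded hexagon :=
  (Metric.isBounded_Icc ((-1, -1) : ℝ × ℝ) (1, 1)).subset fun _ hu =>
    ⟨⟨hu.1, hu.2.2.1⟩, hu.2.1.le, hu.2.2.2.1.le⟩

theorem integrableOn_hexagon {F : ℝ × ℝ → ℂ} (hF : Continuous F) : IntegrableOn F hexagon :=
  (hF.continuousOn.integrableOn_compact isBounded_hexagon.isCompact_closure).mono_set
    subset_closure

theorem setIntegral_OmegaH {F : ℝ × ℝ × ℝ → ℂ} (hF : Continuous F) :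
    ∫ x in OmegaH, F (Tmap x) =
      ((2 / Real.sqrt 3 : ℝ) : ℂ) * ∫ u in hexagon, F (u.1, u.2, -u.1 - u.2) := by
  have h3 : (0 : ℝ) < Real.sqrt 3 := by positivity
  have hdet : LinearMap.det homogeneousCoord ≠ 0 := by
    rw [det_homogeneousCoord]; positivity
  have hmap := Measure.map_linearMap_addHaar_eq_smul_addHaar (volume : Measure (ℝ × ℝ)) hdet
  have hset : OmegaH = homogeneousCoord ⁻¹' hexagon := by
    ext x
    have e : ∀ a b : ℝ, -(-a / 2 - b / 2) = -a / 2 + b / 2 + a := fun a b => by ring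
    simp only [OmegaH, hexagon, homogeneousCoord, Tmap, Set.mem_ofPred_eq, Set.mem_preimage,
      LinearMap.coe_mk, AddHom.coe_mk, e]
  have hcont : Continuous homogeneousCoord := homogeneousCoord.continuous_of_finiteDimensional
  have hcomp := setIntegral_map (μ := volume) (f := fun u : ℝ × ℝ => F (u.1, u.2, -u.1 - u.2))
    measurableSet_hexagon (by fun_prop) hcont.aemeasurable
  rw [hmap, Measure.restrict_smul, integral_smul_measure, ← hset] at hcomp
  have hT : ∀ x, F ((homogeneousCoord x).1, (homogeneousCoord x).2,
      -(homogeneousCoord x).1 - (homogeneousCoord x).2) = F (Tmap x) := by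
    intro x
    simp only [homogeneousCoord, Tmap, LinearMap.coe_mk, AddHom.coe_mk]
    congr 3
    ring
  simp only [hT] at hcomp
  rw [← hcomp, det_homogeneousCoord, abs_of_pos (by positivity),
    ENNReal.toReal_ofReal (by positivity), Complex.real_smul, inv_div]

theorem setIntegral_hexagon_eq_rectangle {F : ℝ × ℝ → ℂ} (hF : Continuous F)
    (hper : ∀ u, F (u + (1, 1)) = F u) :
    ∫ u in hexagon, F u = ∫ u in Set.Ico (0 : ℝ) 1 ×ˢ Set.Ico (-1 : ℝ) 2, F u := by
  have hpos : MeasurableSet {u : ℝ × ℝ | 0 ≤ u.1} := measurableSet_le (by fun_prop) (by fun_prop)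
  have hsum : MeasurableSet {u : ℝ × ℝ | u.1 + u.2 < 1} :=
    measurableSet_lt (by fun_prop) (by fun_prop)
  have hR : IntegrableOn F (Set.Ico (0 : ℝ) 1 ×ˢ Set.Ico (-1 : ℝ) 2) :=
    (hF.continuousOn.integrableOn_compact (isCompact_Icc.prod isCompact_Icc)).mono_set
      (Set.prod_mono Set.Ico_subset_Icc_self Set.Ico_subset_Icc_self)
  rw [← integral_inter_add_sdiff hpos (integrableOn_hexagon hF),
    ← integral_inter_add_sdiff hsum hR]
  congr 1
  · congr 2
    ext ⟨a, b⟩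
    simp only [hexagon, Set.mem_inter_iff, Set.mem_ofPred_eq, Set.mem_prod, Set.mem_Ico]
    constructor
    · rintro ⟨⟨_, _, _, _, _, _⟩, _⟩
      refine ⟨⟨⟨?_, ?_⟩, ?_, ?_⟩, ?_⟩ <;> linarith
    · rintro ⟨⟨⟨_, _⟩, _, _⟩, _⟩
      refine ⟨⟨?_, ?_, ?_, ?_, ?_, ?_⟩, ?_⟩ <;> linarith
  · rw [← (measurePreserving_add_right volume ((1, 1) : ℝ × ℝ)).setIntegral_preimage_emb
      (measurableEmbedding_addRight _) F
      ((Set.Ico (0 : ℝ) 1 ×ˢ Set.Ico (-1 : ℝ) 2) \ {u | u.1 + u.2 < 1})]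
    simp only [hper]
    congr 2
    ext ⟨a, b⟩
    simp only [hexagon, Set.mem_sdiff, Set.mem_ofPred_eq, Set.mem_preimage, Set.mem_prod,
      Set.mem_Ico, Prod.mk_add_mk, not_le, not_lt]
    constructor
    · rintro ⟨⟨_, _, _, _, _, _⟩, _⟩
      refine ⟨⟨⟨?_, ?_⟩, ?_, ?_⟩, ?_⟩ <;> linarith
    · rintro ⟨⟨⟨_, _⟩, _, _⟩, _⟩
      refine ⟨⟨?_, ?_, ?_, ?_, ?_, ?_⟩, ?_⟩ <;> linarith

theorem setIntegral_exp_eq_zero {c : ℂ} (hc : c ≠ 0) {a b : ℝ} (hab : a ≤ b)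
    (hper : Complex.exp (c * (b - a)) = 1) :
    ∫ x in Set.Ico a b, Complex.exp (c * x) = 0 := by
  rw [integral_Ico_eq_integral_Ioc, ← intervalIntegral.integral_of_le hab,
    integral_exp_mul_complex hc]
  have : Complex.exp (c * b) = Complex.exp (c * a) := by
    rw [← one_mul (Complex.exp (c * a)), ← hper, ← Complex.exp_add]
    ring_nf
  rw [this, sub_self, zero_div]

theorem phi_eq_exp_mul_exp {k : ℤ × ℤ × ℤ} (hk : k.1 + k.2.1 + k.2.2 = 0) (a b : ℝ) :
    phi k (a, b, -a - b) =
      Complex.exp (2 * π * Complex.I * ((2 * k.1 + k.2.1 : ℤ) : ℂ) / 3 * a) *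
        Complex.exp (2 * π * Complex.I * ((k.1 + 2 * k.2.1 : ℤ) : ℂ) / 3 * b) := by
  have h : k.2.2 = -k.1 - k.2.1 := by omega
  rw [phi, ← Complex.exp_add, h]
  push_cast
  ring_nf

theorem setIntegral_hexagon_phi {k : ℤ × ℤ × ℤ} (hk : k.1 + k.2.1 + k.2.2 = 0) :
    ∫ u in hexagon, phi k (u.1, u.2, -u.1 - u.2) = if k = 0 then 3 else 0 := by
  have hcont : Continuous fun u : ℝ × ℝ => phi k (u.1, u.2, -u.1 - u.2) :=
    (continuous_phi k).comp (by fun_prop)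
  rw [setIntegral_hexagon_eq_rectangle hcont]
  · split_ifs with h0
    · subst h0
      simp only [phi_zero]
      rw [setIntegral_const, measureReal_def, Measure.volume_eq_prod, Measure.prod_prod]
      norm_num
    · simp only [phi_eq_exp_mul_exp hk]
      rw [Measure.volume_eq_prod]
      rw [setIntegral_prod_mul
        (fun a : ℝ => Complex.exp (2 * π * Complex.I * ((2 * k.1 + k.2.1 : ℤ) : ℂ) / 3 * a))
        (fun b : ℝ => Complex.exp (2 * π * Complex.I * ((k.1 + 2 * k.2.1 : ℤ) : ℂ) / 3 * b))]
      by_cases hm : k.1 + 2 * k.2.1 = 0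
      · have hm' : 2 * k.1 + k.2.1 = 3 * (-k.2.1) := by omega
        have hk2 : k.2.1 ≠ 0 := by
          intro h
          exact h0 (Prod.ext (by simp; omega) (Prod.ext (by simp; omega) (by simp; omega)))
        rw [setIntegral_exp_eq_zero _ zero_le_one, zero_mul]
        · rw [hm', ← exp_two_pi_mul_int (-k.2.1)]
          push_cast
          ring_nf
        · rw [hm']
          simp [Real.pi_ne_zero, hk2]
      · rw [setIntegral_exp_eq_zero (a := -1) _ (by norm_num), mul_zero]
        · rw [← exp_two_pi_mul_int (k.1 + 2 * k.2.1)]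
          push_cast
          ring_nf
        · have : ((k.1 + 2 * k.2.1 : ℤ) : ℂ) ≠ 0 := by exact_mod_cast hm
          simp only [ne_eq, div_eq_zero_iff, mul_eq_zero, this]
          simp [Real.pi_ne_zero]
  · rintro ⟨a, b⟩
    have h : k.2.2 = -k.1 - k.2.1 := by omega
    simp only [phi, Prod.mk_add_mk, h]
    conv_rhs =>
      rw [← mul_one (Complex.exp _), ← exp_two_pi_mul_int (k.1 + k.2.1), ← Complex.exp_add]
    push_cast
    ring_nf

theorem innerH_phi {k l : ℤ × ℤ × ℤ} (hk : k.1 + k.2.1 + k.2.2 = 0)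
    (hl : l.1 + l.2.1 + l.2.2 = 0) :
    innerH (phi k) (phi l) = if k - l = 0 then 1 else 0 := by
  simp only [innerH, phi_mul_conj_phi]
  rw [setIntegral_OmegaH (continuous_phi _), setIntegral_hexagon_phi (by simp; omega),
    ← mul_assoc, ← Complex.ofReal_mul]
  have h : 1 / (2 * Real.sqrt 3) * (2 / Real.sqrt 3) = 1 / 3 := by
    have := Real.mul_self_sqrt (show (0 : ℝ) ≤ 3 by norm_num)
    field_simp
    nlinarith
  rw [h]
  split_ifs <;> norm_num

/-! ### Sums over the hexagonal lattice points -/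

theorem sum_exp_eq_ite {N : ℕ} (hN : 0 < N) (m c : ℤ) :
    ∑ b ∈ Finset.Ico c (c + N), Complex.exp (2 * π * Complex.I * m / N * b) =
      if (N : ℤ) ∣ m then (N : ℂ) else 0 := by
  have hN' : (N : ℂ) ≠ 0 := by exact_mod_cast hN.ne'
  split_ifs with h
  · obtain ⟨q, rfl⟩ := h
    rw [Finset.sum_congr rfl fun b _ => (show _ = (1 : ℂ) from ?_)]
    · simp
    · rw [← exp_two_pi_mul_int (q * b)]
      congr 1
      push_cast
      field_simp
  · set ζ := Complex.exp (2 * π * Complex.I * m / N) with hζ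
    have hζ1 : ζ ≠ 1 := by
      intro h1
      obtain ⟨q, hq⟩ := Complex.exp_eq_one_iff.1 h1
      apply h
      refine ⟨q, ?_⟩
      have h2 : (2 * π * Complex.I : ℂ) ≠ 0 := Complex.two_pi_I_ne_zero
      rw [div_eq_iff hN'] at hq
      have h3 : (m : ℂ) = N * q := mul_left_cancel₀ h2 (by linear_combination hq)
      exact_mod_cast h3
    have hζN : ζ ^ N = 1 := by
      rw [hζ, ← Complex.exp_nat_mul, mul_div_cancel₀ _ hN', exp_two_pi_mul_int]
    have key : ∑ b ∈ Finset.Ico c (c + N), Complex.exp (2 * π * Complex.I * m / N * b) =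
        ∑ i ∈ Finset.range N, Complex.exp (2 * π * Complex.I * m / N * c) * ζ ^ i := by
      refine Finset.sum_nbij' (fun b => (b - c).toNat) (fun i => c + i) ?_ ?_ ?_ ?_ ?_
      · intro b hb; simp only [Finset.mem_Ico, Finset.mem_range] at *; omega
      · intro b hb; simp only [Finset.mem_Ico, Finset.mem_range] at *; omega
      · intro b hb; simp only [Finset.mem_Ico] at *; omega
      · intro b hb; simp
      · intro b hb
        have hbc : (((b - c).toNat : ℕ) : ℂ) = b - c := by
          have : (((b - c).toNat : ℕ) : ℤ) = b - c := by
            simp only [Finset.mem_Ico] at hb; omega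
          exact_mod_cast congrArg (Int.cast : ℤ → ℂ) this
        rw [hζ, ← Complex.exp_nat_mul, ← Complex.exp_add, hbc]
        ring_nf
    rw [key, ← Finset.mul_sum, geom_sum_eq hζ1, hζN, sub_self, zero_div, mul_zero]

theorem finite_Hstar (n : ℕ) : (Hstar n).Finite :=
  (Set.finite_Icc ((-n, -n, -n) : ℤ × ℤ × ℤ) (n, n, n)).subset fun _ hj =>
    ⟨⟨hj.2.1, hj.2.2.2.1, hj.2.2.2.2.2.1⟩, hj.2.2.1, hj.2.2.2.2.1, hj.2.2.2.2.2.2⟩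

theorem Hn_subset_Hstar (n : ℕ) : Hn n ⊆ Hstar n := by
  rintro ⟨a, b, c⟩ h
  simp only [Hn, Hstar, Set.mem_ofPred_eq] at *
  omega

theorem finite_Hn (n : ℕ) : (Hn n).Finite := (finite_Hstar n).subset (Hn_subset_Hstar n)

theorem sum_Hn_eq_rectangle {n : ℕ} {F : ℤ × ℤ × ℤ → ℂ}
    (hper : ∀ a b c, F (a + n, b + n, c - 2 * n) = F (a, b, c)) :
    ∑ j ∈ (finite_Hn n).toFinset, F j =
      ∑ p ∈ Finset.Ico (0 : ℤ) (0 + n) ×ˢ Finset.Ico (-n : ℤ) (-n + (3 * n : ℕ)),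
        F (p.1, p.2, -p.1 - p.2) := by
  refine Finset.sum_nbij' (fun j => if 0 ≤ j.1 then (j.1, j.2.1) else (j.1 + n, j.2.1 + n))
    (fun p => if p.1 + p.2 < n then (p.1, p.2, -p.1 - p.2)
      else (p.1 - n, p.2 - n, 2 * n - p.1 - p.2)) ?_ ?_ ?_ ?_ ?_
  · rintro ⟨a, b, c⟩ h
    simp only [Set.Finite.mem_toFinset, Hn, Set.mem_ofPred_eq] at h
    dsimp only
    split_ifs <;> simp only [Finset.mem_product, Finset.mem_Ico] <;> omega
  · rintro ⟨a, b⟩ h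
    simp only [Finset.mem_product, Finset.mem_Ico] at h
    dsimp only
    split_ifs <;> simp only [Set.Finite.mem_toFinset, Hn, Set.mem_ofPred_eq] <;> omega
  · rintro ⟨a, b, c⟩ h
    simp only [Set.Finite.mem_toFinset, Hn, Set.mem_ofPred_eq] at h
    by_cases ha : 0 ≤ a <;> simp only [ha, if_true, if_false] <;> split_ifs <;>
      simp only [Prod.mk.injEq, true_and] <;> omega
  · rintro ⟨a, b⟩ h
    simp only [Finset.mem_product, Finset.mem_Ico] at h
    by_cases hab : a + b < n <;> simp only [hab, if_true, if_false] <;> split_ifs <;>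
      simp only [Prod.mk.injEq] <;> omega
  · rintro ⟨a, b, c⟩ h
    simp only [Set.Finite.mem_toFinset, Hn, Set.mem_ofPred_eq] at h
    dsimp only
    split_ifs
    · congr 3; omega
    · rw [← hper a b c]; congr 3; dsimp only; omega

theorem sub_mem_Hcirc {n : ℕ} {k l : ℤ × ℤ × ℤ} (hk : k ∈ Hn n) (hl : l ∈ Hn n) :
    k - l ∈ Hcirc (2 * n) := by
  simp only [Hn, Hcirc, Set.mem_ofPred_eq, Prod.fst_sub, Prod.snd_sub] at *
  push_cast
  omega

theorem eq_zero_of_mem_Hcirc {n : ℕ} {k : ℤ × ℤ × ℤ} (hk : k ∈ Hcirc (2 * n))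
    (h₁ : (n : ℤ) ∣ k.2.1) (h₂ : ((3 * n : ℕ) : ℤ) ∣ k.1 + 2 * k.2.1) : k = 0 := by
  obtain ⟨a, b, c⟩ := k
  obtain ⟨p, hp⟩ := h₁
  obtain ⟨q, hq⟩ := h₂
  simp only [Hcirc, Set.mem_ofPred_eq] at *
  push_cast at *
  have ha : a = n * (3 * q - 2 * p) := by linarith
  have hc : c = n * (p - 3 * q) := by linarith
  obtain ⟨_, h1, h2, h3, h4, h5, h6⟩ := hk
  have hn : (0 : ℤ) < n := by omega
  have bound : ∀ x y : ℤ, x = n * y → -(2 * (n : ℤ)) < x → x < 2 * n → -2 < y ∧ y < 2 := by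
    rintro x y rfl hl hu
    constructor <;> nlinarith
  have hap := bound _ _ ha h1 h2
  have hbp := bound _ _ hp h3 h4
  have hcp := bound _ _ hc h5 h6
  have hp0 : p = 0 := by omega
  have hq0 : q = 0 := by omega
  subst hp0 hq0
  simp_all

theorem sum_Hn_phi {n : ℕ} (hn : 1 ≤ n) {k : ℤ × ℤ × ℤ} (hk : k ∈ Hcirc (2 * n)) :
    ∑ j ∈ (finite_Hn n).toFinset, phi k (pt n j) = if k = 0 then 3 * (n : ℂ) ^ 2 else 0 := by
  have hn0 : (n : ℂ) ≠ 0 := by exact_mod_cast (by omega : n ≠ 0)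
  have hk0 : k.2.2 = -k.1 - k.2.1 := by have := hk.1; omega
  rw [sum_Hn_eq_rectangle]
  · have hterm : ∀ p : ℤ × ℤ, phi k (pt n (p.1, p.2, -p.1 - p.2)) =
        Complex.exp (2 * π * Complex.I * (2 * k.1 + k.2.1 : ℤ) / (3 * n : ℕ) * p.1) *
        Complex.exp (2 * π * Complex.I * (k.1 + 2 * k.2.1 : ℤ) / (3 * n : ℕ) * p.2) := by
      intro p
      rw [phi, ← Complex.exp_add, hk0]
      congr 1
      simp only [pt]
      push_cast
      field_simp
      ring
    simp only [hterm]
    rw [Finset.sum_product]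
    dsimp only
    rw [← Finset.sum_mul_sum, sum_exp_eq_ite (by omega)]
    split_ifs with hd h0 h0
    · subst h0
      simp
      ring
    · obtain ⟨q, hq⟩ := hd
      have hterm' : ∀ a : ℤ,
          Complex.exp (2 * π * Complex.I * (2 * k.1 + k.2.1 : ℤ) / (3 * n : ℕ) * a) =
          Complex.exp (2 * π * Complex.I * (-k.2.1 : ℤ) / n * a) := by
        intro a
        have hm : 2 * k.1 + k.2.1 = 2 * ((3 * n : ℕ) * q) - 3 * k.2.1 := by omega
        rw [hm, ← mul_one (Complex.exp (2 * π * Complex.I * (-k.2.1 : ℤ) / n * a)),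
          ← exp_two_pi_mul_int (2 * q * a), ← Complex.exp_add]
        congr 1
        push_cast
        field_simp
        ring
      simp only [hterm']
      rw [sum_exp_eq_ite (by omega), if_neg, zero_mul]
      intro hd2
      exact h0 (eq_zero_of_mem_Hcirc hk ((dvd_neg).1 hd2) ⟨q, hq⟩)
    · subst h0
      simp at hd
    · rw [mul_zero]
  · intro a b c
    simp only [phi, pt, hk0]
    rw [← mul_one (Complex.exp (2 * π * Complex.I * (_ * ((a / n : ℝ) : ℂ) + _ + _) / 3)),
      ← exp_two_pi_mul_int (k.1 + k.2.1), ← Complex.exp_add]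
    congr 1
    push_cast
    field_simp
    ring

/-! ### The symmetric weights -/

/-- The rotation of the hexagonal lattice by a sixth of a turn. -/
def rot : Equiv.Perm (ℤ × ℤ × ℤ) where
  toFun j := (-j.2.1, -j.2.2, -j.1)
  invFun j := (-j.2.2, -j.1, -j.2.1)
  left_inv j := by simp
  right_inv j := by simp

theorem rot_apply (a b c : ℤ) : rot (a, b, c) = (-b, -c, -a) := rfl

theorem cwt_eq_sum_rot {n : ℕ} (hn : 1 ≤ n) {j : ℤ × ℤ × ℤ} (hj : j ∈ Hstar n) :
    cwt n j = 1 / 6 * ∑ i ∈ Finset.range 6, if (rot ^ i) j ∈ Hn n then (1 : ℝ) else 0 := by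
  obtain ⟨a, b, c⟩ := j
  simp only [Finset.sum_range_succ, Finset.sum_range_zero, zero_add, pow_succ, pow_zero, one_mul,
    Equiv.Perm.mul_apply, rot_apply, Hn, Set.mem_ofPred_eq, cwt, Equiv.Perm.one_apply, neg_neg,
    ne_eq, mul_eq_zero, not_or]
  simp only [Hstar, Set.mem_ofPred_eq] at hj
  split_ifs <;> first | omega | norm_num

theorem rot_mem_Hstar_iff {n : ℕ} {j : ℤ × ℤ × ℤ} : rot j ∈ Hstar n ↔ j ∈ Hstar n := by
  obtain ⟨a, b, c⟩ := j
  simp only [rot_apply, Hstar, Set.mem_ofPred_eq]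
  omega

theorem rot_mem_Hcirc_iff {n : ℕ} {j : ℤ × ℤ × ℤ} : rot j ∈ Hcirc n ↔ j ∈ Hcirc n := by
  obtain ⟨a, b, c⟩ := j
  simp only [rot_apply, Hcirc, Set.mem_ofPred_eq]
  omega

theorem rot_pow_mem_iff {s : Set (ℤ × ℤ × ℤ)} (hs : ∀ {j}, rot j ∈ s ↔ j ∈ s) (i : ℕ)
    {j : ℤ × ℤ × ℤ} : (rot ^ i) j ∈ s ↔ j ∈ s := by
  induction i with
  | zero => simp
  | succ i ih => rw [pow_succ', Equiv.Perm.mul_apply, hs, ih]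

theorem phi_rot_pt_rot (n : ℕ) (k j : ℤ × ℤ × ℤ) :
    phi (rot k) (pt n (rot j)) = phi k (pt n j) := by
  simp only [phi, pt, rot, Equiv.coe_fn_mk]
  push_cast
  ring_nf

theorem phi_rot_pow_pt_rot_pow (n i : ℕ) (k j : ℤ × ℤ × ℤ) :
    phi ((rot ^ i) k) (pt n ((rot ^ i) j)) = phi k (pt n j) := by
  induction i with
  | zero => simp
  | succ i ih => rw [pow_succ', Equiv.Perm.mul_apply, Equiv.Perm.mul_apply, phi_rot_pt_rot, ih]

theorem rot_pow_eq_zero_iff (i : ℕ) {k : ℤ × ℤ × ℤ} : (rot ^ i) k = 0 ↔ k = 0 :=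
  rot_pow_mem_iff (s := {0}) (fun {j} => by simp [rot, Prod.ext_iff]; omega) i

theorem sum_Hstar_phi {n : ℕ} (hn : 1 ≤ n) {k : ℤ × ℤ × ℤ} (hk : k ∈ Hcirc (2 * n)) :
    ∑ j ∈ (finite_Hstar n).toFinset, ((cwt n j : ℝ) : ℂ) * phi k (pt n j) =
      if k = 0 then 3 * (n : ℂ) ^ 2 else 0 := by
  have hrot : ∀ i : ℕ, ∑ j ∈ (finite_Hstar n).toFinset,
      (if (rot ^ i) j ∈ Hn n then phi k (pt n j) else 0) =
      if k = 0 then 3 * (n : ℂ) ^ 2 else 0 := by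
    intro i
    rw [Finset.sum_equiv (rot ^ i) (t := (finite_Hstar n).toFinset)
      (g := fun j => if j ∈ Hn n then phi ((rot ^ i) k) (pt n j) else 0)
      (by simp [rot_pow_mem_iff rot_mem_Hstar_iff])
      (fun j _ => by simp only [phi_rot_pow_pt_rot_pow]), ← Finset.sum_filter]
    have hfilter : (finite_Hstar n).toFinset.filter (· ∈ Hn n) = (finite_Hn n).toFinset := by
      ext j
      simpa using fun h => Hn_subset_Hstar n h
    rw [hfilter, sum_Hn_phi hn ((rot_pow_mem_iff rot_mem_Hcirc_iff i).2 hk)]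
    simp only [rot_pow_eq_zero_iff]
  have hterm : ∀ j ∈ (finite_Hstar n).toFinset, ((cwt n j : ℝ) : ℂ) * phi k (pt n j) =
      1 / 6 * ∑ i ∈ Finset.range 6, if (rot ^ i) j ∈ Hn n then phi k (pt n j) else 0 := by
    intro j hj
    rw [cwt_eq_sum_rot hn ((finite_Hstar n).mem_toFinset.1 hj)]
    push_cast
    rw [mul_assoc, Finset.sum_mul]
    refine congrArg _ (Finset.sum_congr rfl fun i _ => ?_)
    split_ifs <;> simp
  rw [Finset.sum_congr rfl hterm, ← Finset.mul_sum, Finset.sum_comm]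
  simp only [hrot]
  simp

/-! ### Extension to the linear span -/

theorem continuous_of_mem_span_phi {s : Set (ℤ × ℤ × ℤ)} {f : ℝ × ℝ × ℝ → ℂ}
    (hf : f ∈ Submodule.span ℂ {F | ∃ j ∈ s, F = phi j}) : Continuous f := by
  induction hf using Submodule.span_induction with
  | mem f h => obtain ⟨j, -, rfl⟩ := h; exact continuous_phi j
  | zero => exact continuous_const
  | add f g _ _ hf hg => exact hf.add hg
  | smul c f _ hf => exact hf.const_smul c

theorem isBounded_OmegaH : Bornology.IsBounded OmegaH := by
  have hle : 1 ≤ Real.sqrt 3 := Real.one_le_sqrt.2 (by norm_num)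
  refine (Metric.isBounded_Icc ((-3, -1) : ℝ × ℝ) (3, 1)).subset fun x hx => ?_
  simp only [OmegaH, Tmap, Set.mem_ofPred_eq] at hx
  obtain ⟨h1, h2, h3, h4, h5, h6⟩ := hx
  refine ⟨⟨?_, h3⟩, ?_, h4.le⟩ <;> dsimp only <;> nlinarith

theorem integrableOn_OmegaH {f g : ℝ × ℝ × ℝ → ℂ} (hf : Continuous f) (hg : Continuous g) :
    IntegrableOn (fun x => f (Tmap x) * (starRingEnd ℂ) (g (Tmap x))) OmegaH := by
  have hT : Continuous Tmap := by unfold Tmap; fun_prop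
  have hc : Continuous fun x => f (Tmap x) * (starRingEnd ℂ) (g (Tmap x)) :=
    (hf.comp hT).mul (Complex.continuous_conj.comp (hg.comp hT))
  exact (hc.continuousOn.integrableOn_compact isBounded_OmegaH.isCompact_closure).mono_set
    subset_closure

theorem innerH_eq_sum_of_phi {n : ℕ} {s : Finset (ℤ × ℤ × ℤ)} {w : ℤ × ℤ × ℤ → ℂ}
    (hn : 1 ≤ n)
    (hw : ∀ k ∈ Hcirc (2 * n), ∑ j ∈ s, w j * phi k (pt n j) =
      if k = 0 then 3 * (n : ℂ) ^ 2 else 0)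
    {f g : ℝ × ℝ × ℝ → ℂ}
    (hf : f ∈ Submodule.span ℂ {F | ∃ j ∈ Hn n, F = phi j})
    (hg : g ∈ Submodule.span ℂ {F | ∃ j ∈ Hn n, F = phi j}) :
    innerH f g = ((1 / (3 * (n : ℝ) ^ 2) : ℝ) : ℂ) *
      ∑ j ∈ s, w j * (f (pt n j) * (starRingEnd ℂ) (g (pt n j))) := by
  have hn0 : (n : ℂ) ≠ 0 := by exact_mod_cast (by omega : n ≠ 0)
  induction hf, hg using Submodule.span_induction₂ with
  | mem_mem f g hf hg =>
    obtain ⟨k, hk, rfl⟩ := hf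
    obtain ⟨l, hl, rfl⟩ := hg
    rw [innerH_phi hk.1 hl.1]
    simp only [phi_mul_conj_phi]
    rw [hw _ (sub_mem_Hcirc hk hl)]
    split_ifs
    · push_cast
      field_simp
    · rw [mul_zero]
  | zero_left => simp [innerH]
  | zero_right => simp [innerH]
  | add_left f₁ f₂ g hf₁ hf₂ hg h₁ h₂ =>
    have hadd : innerH (f₁ + f₂) g = innerH f₁ g + innerH f₂ g := by
      simp only [innerH, Pi.add_apply, add_mul]
      rw [integral_add (integrableOn_OmegaH (continuous_of_mem_span_phi hf₁)
        (continuous_of_mem_span_phi hg)) (integrableOn_OmegaH (continuous_of_mem_span_phi hf₂)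
        (continuous_of_mem_span_phi hg)), mul_add]
    rw [hadd, h₁, h₂, ← mul_add, ← Finset.sum_add_distrib]
    simp only [Pi.add_apply, add_mul, mul_add]
  | add_right f g₁ g₂ hf hg₁ hg₂ h₁ h₂ =>
    have hadd : innerH f (g₁ + g₂) = innerH f g₁ + innerH f g₂ := by
      simp only [innerH, Pi.add_apply, map_add, mul_add]
      rw [integral_add (integrableOn_OmegaH (continuous_of_mem_span_phi hf)
        (continuous_of_mem_span_phi hg₁)) (integrableOn_OmegaH (continuous_of_mem_span_phi hf)
        (continuous_of_mem_span_phi hg₂)), mul_add]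
    rw [hadd, h₁, h₂, ← mul_add, ← Finset.sum_add_distrib]
    simp only [Pi.add_apply, map_add, mul_add]
  | smul_left c f g _ _ h =>
    have hsmul : innerH (c • f) g = c * innerH f g := by
      simp only [innerH, Pi.smul_apply, smul_eq_mul, mul_assoc]
      rw [integral_const_mul, mul_left_comm]
    rw [hsmul, h, mul_left_comm, Finset.mul_sum]
    simp only [Pi.smul_apply, smul_eq_mul]
    congr 1
    exact Finset.sum_congr rfl fun _ _ => by ring
  | smul_right c f g _ _ h =>
    have hsmul : innerH f (c • g) = (starRingEnd ℂ) c * innerH f g := by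
      simp only [innerH, Pi.smul_apply, smul_eq_mul, map_mul, mul_left_comm _ ((starRingEnd ℂ) c)]
      rw [integral_const_mul, mul_left_comm]
    rw [hsmul, h, mul_left_comm, Finset.mul_sum]
    simp only [Pi.smul_apply, smul_eq_mul, map_mul]
    congr 1
    exact Finset.sum_congr rfl fun _ _ => by ring

theorem stmt_4 (n : ℕ) (hn : 1 ≤ n) (f g : ℝ × ℝ × ℝ → ℂ)
    (hf : f ∈ Submodule.span ℂ {F | ∃ j ∈ Hn n, F = phi j})
    (hg : g ∈ Submodule.span ℂ {F | ∃ j ∈ Hn n, F = phi j}) :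
    innerH f g =
      ((1 / (3 * (n : ℝ) ^ 2) : ℝ) : ℂ) *
        ∑ᶠ j ∈ Hn n, f (pt n j) * (starRingEnd ℂ) (g (pt n j)) ∧
    innerH f g =
      ((1 / (3 * (n : ℝ) ^ 2) : ℝ) : ℂ) *
        ∑ᶠ j ∈ Hstar n,
          ((cwt n j : ℝ) : ℂ) * (f (pt n j) * (starRingEnd ℂ) (g (pt n j))) := by
  constructor
  · rw [finsum_mem_eq_finite_toFinset_sum _ (finite_Hn n)]
    simpa using innerH_eq_sum_of_phi (s := (finite_Hn n).toFinset) (w := fun _ => 1) hn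
      (fun k hk => by simpa using sum_Hn_phi hn hk) hf hg
  · rw [finsum_mem_eq_finite_toFinset_sum _ (finite_Hstar n)]
    exact innerH_eq_sum_of_phi hn (fun k hk => sum_Hstar_phi hn hk) hf hg
end
end
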